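/- arXiv:2212.14838 — 3 statements merged into one kernel-verified Lean document; each statement's English description precedes it below -/
import Mathlib

section
/- For all integers m ≥ 1 and r ≥ 0, the Gamma function satisfies the inequality (2^{r/2} · Γ((m+r)/2) / Γ(m/2))² ≤ 4 · (m + r − 1)!. (The Gamma-function inequality established by induction on r in the proof of Lemma B.2.) -/
lemma Gamma_half_sq_le (x : ℝ) (hx : 0 < x) :
    Real.Gamma (x + 1 / 2) ^ 2 ≤ x * Real.Gamma x ^ 2 := by
  have h := Real.Gamma_mul_add_mul_le_rpow_Gamma_mul_rpow_Gamma (s := x) (t := x + 1)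
    (a := 1 / 2) (b := 1 / 2) hx (by linarith) (by norm_num) (by norm_num) (by norm_num)
  have e : (1 / 2 : ℝ) * x + 1 / 2 * (x + 1) = x + 1 / 2 := by ring
  have g := Real.Gamma_pos_of_pos hx
  have g' := Real.Gamma_pos_of_pos (show 0 < x + 1 by linarith)
  have p := Real.Gamma_pos_of_pos (show 0 < x + 1 / 2 by linarith)
  rw [e, ← Real.sqrt_eq_rpow, ← Real.sqrt_eq_rpow] at h
  have h2 := pow_le_pow_left₀ p.le h 2
  rw [mul_pow, Real.sq_sqrt g.le, Real.sq_sqrt g'.le, Real.Gamma_add_one hx.ne'] at h2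
  nlinarith

lemma two_pow_mul_Gamma_sq_le (k : ℕ) : ∀ r : ℕ,
    (2 : ℝ) ^ r * Real.Gamma (((k + 1 : ℕ) + r) / 2) ^ 2 ≤
      4 * (Nat.factorial (k + r) : ℝ) * Real.Gamma ((k + 1 : ℕ) / 2) ^ 2
  | 0 => by
    have h : (1 : ℝ) ≤ (Nat.factorial k : ℝ) := by exact_mod_cast Nat.factorial_pos k
    simp only [pow_zero, Nat.cast_zero, add_zero]
    have := sq_nonneg (Real.Gamma ((k + 1 : ℕ) / 2))
    nlinarith
  | 1 => by
    have h : ((k + 1 : ℕ) : ℝ) ≤ (Nat.factorial (k + 1) : ℝ) := by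
      exact_mod_cast Nat.self_le_factorial _
    have hp : (0 : ℝ) < ((k + 1 : ℕ) : ℝ) := by positivity
    have g := Gamma_half_sq_le (((k + 1 : ℕ) : ℝ) / 2) (by positivity)
    have e : (((k + 1 : ℕ) : ℝ) + (1 : ℕ)) / 2 = ((k + 1 : ℕ) : ℝ) / 2 + 1 / 2 := by
      push_cast; ring
    rw [e]
    have := sq_nonneg (Real.Gamma ((k + 1 : ℕ) / 2))
    nlinarith
  | r + 2 => by
    have ih := two_pow_mul_Gamma_sq_le k r
    have hp : (0 : ℝ) < (((k + 1 : ℕ) : ℝ) + r) / 2 := by positivity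
    have e : (((k + 1 : ℕ) : ℝ) + (r + 2 : ℕ)) / 2 = (((k + 1 : ℕ) : ℝ) + r) / 2 + 1 := by
      push_cast; ring
    have f : (Nat.factorial (k + (r + 2)) : ℝ)
        = ((k : ℝ) + r + 2) * (((k : ℝ) + r + 1) * Nat.factorial (k + r)) := by
      rw [show k + (r + 2) = (k + r + 1) + 1 by ring, Nat.factorial_succ, Nat.factorial_succ]
      push_cast; ring
    rw [e, Real.Gamma_add_one hp.ne', f]
    set G := Real.Gamma ((((k + 1 : ℕ) : ℝ) + r) / 2)
    set H := Real.Gamma (((k + 1 : ℕ) : ℝ) / 2)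
    have hF : (0 : ℝ) ≤ 4 * (Nat.factorial (k + r) : ℝ) * H ^ 2 := by positivity
    calc (2 : ℝ) ^ (r + 2) * ((((k + 1 : ℕ) : ℝ) + r) / 2 * G) ^ 2
        = ((k : ℝ) + r + 1) ^ 2 * (2 ^ r * G ^ 2) := by push_cast; ring
      _ ≤ ((k : ℝ) + r + 1) ^ 2 * (4 * (Nat.factorial (k + r) : ℝ) * H ^ 2) := by gcongr
      _ ≤ (((k : ℝ) + r + 2) * ((k : ℝ) + r + 1)) *
          (4 * (Nat.factorial (k + r) : ℝ) * H ^ 2) := by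
        apply mul_le_mul_of_nonneg_right _ hF
        nlinarith [(Nat.cast_nonneg k : (0 : ℝ) ≤ k), (Nat.cast_nonneg r : (0 : ℝ) ≤ r)]
      _ = _ := by ring

/-- The Gamma-function inequality from the proof of Lemma B.2:
`(2^(r/2) Γ((m+r)/2) / Γ(m/2))² ≤ 4 (m + r − 1)!` for all `m ≥ 1`, `r ≥ 0`. -/
theorem sq_two_rpow_mul_Gamma_div_Gamma_le
    (m : ℕ) (hm : 1 ≤ m) (r : ℕ) :
    ((2 : ℝ) ^ ((r : ℝ) / 2) * Real.Gamma ((m + r) / 2) / Real.Gamma (m / 2)) ^ 2 ≤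
      4 * (Nat.factorial (m + r - 1) : ℝ) := by
  obtain ⟨k, rfl⟩ : ∃ k, m = k + 1 := ⟨m - 1, by omega⟩
  have h := two_pow_mul_Gamma_sq_le k r
  have hp : 0 < Real.Gamma (((k + 1 : ℕ) : ℝ) / 2) := Real.Gamma_pos_of_pos (by positivity)
  have e : ((2 : ℝ) ^ ((r : ℝ) / 2)) ^ 2 = 2 ^ r := by
    rw [← Real.rpow_natCast, ← Real.rpow_mul (by norm_num), ← Real.rpow_natCast]
    congr 1
    push_cast; ring
  rw [show k + 1 + r - 1 = k + r by omega, div_pow, mul_pow, e, div_le_iff₀ (by positivity)]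
  exact h
end

section
/- Let n ≥ 1 and let A be a real n×n matrix with Σ_{k=0}^∞ ‖A^k‖₂ convergent, K a real n×m matrix, Q an m×m real positive semidefinite matrix, C a real p×n matrix, and S a real m×p matrix with ‖S‖₂ ≤ 1. Set P = Σ_{k=0}^∞ A^k K Q Kᵀ (A^k)ᵀ and σ_A = Σ_{k=0}^∞ ‖A^k‖₂. Then: (i) for every integer l ≥ 1, ‖C A^{l−1} (A P Cᵀ + K Q S)‖₂ ≤ (‖C‖₂² ‖K‖₂² + ‖C‖₂ ‖K‖₂) · σ_A³ · μ_max(Q); and (ii) ‖C P Cᵀ + Sᵀ Q S‖₂ ≤ (‖C‖₂² ‖K‖₂² + 1) · σ_A² · μ_max(Q). (The covariance-norm bounds of Lemma B.6.) -/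
open Matrix

/-- The operator norm of a real matrix induced by the Euclidean norms. -/
noncomputable def opNorm2 {α β : Type*} [Fintype α] [Fintype β] [DecidableEq α] [DecidableEq β]
    (M : Matrix α β ℝ) : ℝ :=
  ‖LinearMap.toContinuousLinearMap (Matrix.toEuclideanLin M)‖

/-- A largest-eigenvalue function for positive semidefinite matrices. -/
noncomputable def maxEig {m : ℕ} {Q : Matrix (Fin m) (Fin m) ℝ}
    (hQ : Q.PosSemidef) : ℝ :=
  ⨆ i, hQ.1.eigenvalues i


section Helpers

variable {a b c : ℕ}

lemma opNorm2_nonneg (M : Matrix (Fin a) (Fin b) ℝ) : 0 ≤ opNorm2 M := norm_nonneg _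

lemma opNorm2_add_le (M N : Matrix (Fin a) (Fin b) ℝ) :
    opNorm2 (M + N) ≤ opNorm2 M + opNorm2 N := by
  unfold opNorm2
  rw [map_add, map_add]
  exact norm_add_le _ _

open scoped Matrix.Norms.L2Operator in
lemma opNorm2_eq_norm (M : Matrix (Fin a) (Fin b) ℝ) : opNorm2 M = ‖M‖ := rfl

lemma opNorm2_mul_le_of {M : Matrix (Fin a) (Fin b) ℝ} {N : Matrix (Fin b) (Fin c) ℝ} {x y : ℝ}
    (hM : opNorm2 M ≤ x) (hN : opNorm2 N ≤ y) : opNorm2 (M * N) ≤ x * y :=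
  (Matrix.l2_opNorm_mul M N).trans
    (mul_le_mul hM hN (opNorm2_nonneg N) ((opNorm2_nonneg M).trans hM))

lemma opNorm2_transpose (M : Matrix (Fin a) (Fin b) ℝ) : opNorm2 Mᵀ = opNorm2 M := by
  rw [← Matrix.conjTranspose_eq_transpose_of_trivial]
  exact Matrix.l2_opNorm_conjTranspose M

open scoped Matrix.Norms.L2Operator in
lemma one_le_opNorm2_one (ha : 1 ≤ a) : 1 ≤ opNorm2 (1 : Matrix (Fin a) (Fin a) ℝ) := by
  have : Nonempty (Fin a) := ⟨⟨0, ha⟩⟩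
  rw [opNorm2_eq_norm, CStarRing.norm_one]

lemma opNorm2_tsum_le {f : ℕ → Matrix (Fin a) (Fin b) ℝ} {g : ℕ → ℝ} {x : ℝ}
    (hg : HasSum g x) (h : ∀ i, opNorm2 (f i) ≤ g i) : opNorm2 (∑' i, f i) ≤ x := by
  open scoped Matrix.Norms.L2Operator in
  exact tsum_of_norm_bounded (E := Matrix (Fin a) (Fin b) ℝ) (f := f) hg h

lemma maxEig_nonneg {Q : Matrix (Fin a) (Fin a) ℝ} (hQ : Q.PosSemidef) : 0 ≤ maxEig hQ :=
  Real.iSup_nonneg fun i => hQ.eigenvalues_nonneg i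

open scoped Matrix.Norms.L2Operator in
lemma opNorm2_le_maxEig {Q : Matrix (Fin a) (Fin a) ℝ} (hQ : Q.PosSemidef) :
    opNorm2 Q ≤ maxEig hQ := by
  rw [opNorm2_eq_norm]
  conv_lhs => rw [hQ.1.spectral_theorem, Unitary.conjStarAlgAut_apply]
  rw [← Unitary.coe_star, CStarRing.norm_mul_coe_unitary, CStarRing.norm_coe_unitary_mul,
    Matrix.l2_opNorm_diagonal, pi_norm_le_iff_of_nonneg (maxEig_nonneg hQ)]
  intro i
  have h : hQ.1.eigenvalues i ≤ maxEig hQ := le_ciSup (Set.finite_range _).bddAbove i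
  simpa [abs_of_nonneg (hQ.eigenvalues_nonneg i)] using h

end Helpers

/-- The covariance-norm bounds of Lemma B.6. With `P = Σ_k A^k K Q Kᵀ (A^k)ᵀ` and
`σ_A = Σ_k ‖A^k‖₂`:
(i) for every `l ≥ 1`, `‖C A^(l-1) (A P Cᵀ + K Q S)‖₂ ≤ (‖C‖₂²‖K‖₂² + ‖C‖₂‖K‖₂) σ_A³ μ_max(Q)`;
(ii) `‖C P Cᵀ + Sᵀ Q S‖₂ ≤ (‖C‖₂²‖K‖₂² + 1) σ_A² μ_max(Q)`. -/
theorem covariance_norm_bounds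
    (n m p : ℕ) (hn : 1 ≤ n) (A : Matrix (Fin n) (Fin n) ℝ)
    (hA : Summable fun k : ℕ => opNorm2 (A ^ k))
    (K : Matrix (Fin n) (Fin m) ℝ) (Q : Matrix (Fin m) (Fin m) ℝ) (hQ : Q.PosSemidef)
    (C : Matrix (Fin p) (Fin n) ℝ) (S : Matrix (Fin m) (Fin p) ℝ) (hS : opNorm2 S ≤ 1)
    (P : Matrix (Fin n) (Fin n) ℝ) (hP : P = ∑' k : ℕ, A ^ k * K * Q * Kᵀ * (A ^ k)ᵀ)
    (σA : ℝ) (hσA : σA = ∑' k : ℕ, opNorm2 (A ^ k)) :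
    (∀ l : ℕ, 1 ≤ l →
        opNorm2 (C * A ^ (l - 1) * (A * P * Cᵀ + K * Q * S)) ≤
          (opNorm2 C ^ 2 * opNorm2 K ^ 2 + opNorm2 C * opNorm2 K) * σA ^ 3 * maxEig hQ) ∧
      opNorm2 (C * P * Cᵀ + Sᵀ * Q * S) ≤
        (opNorm2 C ^ 2 * opNorm2 K ^ 2 + 1) * σA ^ 2 * maxEig hQ := by
  have q0 : 0 ≤ maxEig hQ := maxEig_nonneg hQ
  have hq := opNorm2_le_maxEig hQ
  have c0 := opNorm2_nonneg C
  have k0 := opNorm2_nonneg K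
  have s0 := opNorm2_nonneg S
  have hAσ : ∀ k, opNorm2 (A ^ k) ≤ σA := fun k => by
    rw [hσA]; exact hA.le_tsum k (fun j _ => opNorm2_nonneg _)
  have hσ1 : 1 ≤ σA := by
    have h := hAσ 0
    rw [pow_zero] at h
    exact (one_le_opNorm2_one hn).trans h
  have hσ0 : 0 ≤ σA := by linarith
  have hPn : opNorm2 P ≤ σA ^ 2 * opNorm2 K ^ 2 * maxEig hQ := by
    have hs : HasSum (fun k => opNorm2 (A ^ k) * (σA * opNorm2 K ^ 2 * maxEig hQ))
        (σA * (σA * opNorm2 K ^ 2 * maxEig hQ)) := by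
      have h := hA.hasSum
      rw [← hσA] at h
      exact h.mul_right _
    have := opNorm2_tsum_le hs (f := fun k => A ^ k * K * Q * Kᵀ * (A ^ k)ᵀ) (fun k => by
      have a0 := opNorm2_nonneg (A ^ k)
      calc opNorm2 (A ^ k * K * Q * Kᵀ * (A ^ k)ᵀ)
          ≤ opNorm2 (A ^ k) * opNorm2 K * maxEig hQ * opNorm2 K * σA := by
            refine opNorm2_mul_le_of (opNorm2_mul_le_of (opNorm2_mul_le_of
              (opNorm2_mul_le_of le_rfl le_rfl) hq) ?_) ?_
            · rw [opNorm2_transpose]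
            · rw [opNorm2_transpose]; exact hAσ k
        _ = _ := by ring)
    rw [hP]
    refine this.trans (le_of_eq (by ring))
  have hCt : opNorm2 Cᵀ ≤ opNorm2 C := (opNorm2_transpose C).le
  constructor
  · intro l hl
    obtain ⟨j, rfl⟩ : ∃ j, l = j + 1 := ⟨l - 1, by omega⟩
    have e : C * A ^ (j + 1 - 1) * (A * P * Cᵀ + K * Q * S)
        = C * A ^ (j + 1) * P * Cᵀ + C * A ^ j * K * Q * S := by
      rw [Nat.add_sub_cancel, pow_succ]
      simp only [Matrix.mul_add, Matrix.mul_assoc]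
    rw [e]
    have h1 : opNorm2 (C * A ^ (j + 1) * P * Cᵀ) ≤
        opNorm2 C * σA * (σA ^ 2 * opNorm2 K ^ 2 * maxEig hQ) * opNorm2 C :=
      opNorm2_mul_le_of (opNorm2_mul_le_of (opNorm2_mul_le_of le_rfl (hAσ _)) hPn) hCt
    have h2 : opNorm2 (C * A ^ j * K * Q * S) ≤
        opNorm2 C * σA * opNorm2 K * maxEig hQ * 1 :=
      opNorm2_mul_le_of (opNorm2_mul_le_of (opNorm2_mul_le_of
        (opNorm2_mul_le_of le_rfl (hAσ _)) le_rfl) hq) hS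
    have h3 : opNorm2 C * opNorm2 K * maxEig hQ * σA ≤
        opNorm2 C * opNorm2 K * maxEig hQ * σA ^ 3 :=
      mul_le_mul_of_nonneg_left (le_self_pow₀ hσ1 (by norm_num)) (by positivity)
    have h4 := opNorm2_add_le (C * A ^ (j + 1) * P * Cᵀ) (C * A ^ j * K * Q * S)
    linarith
  · have h1 : opNorm2 (C * P * Cᵀ) ≤
        opNorm2 C * (σA ^ 2 * opNorm2 K ^ 2 * maxEig hQ) * opNorm2 C :=
      opNorm2_mul_le_of (opNorm2_mul_le_of le_rfl hPn) hCt
    have h2 : opNorm2 (Sᵀ * Q * S) ≤ 1 * maxEig hQ * 1 :=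
      opNorm2_mul_le_of (opNorm2_mul_le_of ((opNorm2_transpose S).le.trans hS) hq) hS
    have h3 : maxEig hQ * 1 ≤ maxEig hQ * σA ^ 2 :=
      mul_le_mul_of_nonneg_left (one_le_pow₀ hσ1) q0
    have h4 := opNorm2_add_le (C * P * Cᵀ) (Sᵀ * Q * S)
    linarith
end

section
/- Let m ≥ 1 be an integer and let λ > 0, μ > 0, G ≥ 0 be real numbers such that 3(m+1)λμG² < 1. Then the series Σ_{r=2}^∞ (λ^r / r!) · 4(r−1) · 3^r · μ^r · (m + r − 1)! · G^{2r} converges and satisfies Σ_{r=2}^∞ (λ^r / r!) · 4(r−1) · 3^r · μ^r · (m + r − 1)! · G^{2r} ≤ 2 · (m+1)! · (3λμG²)² / (1 − 3(m+1)λμG²). (The series estimate at the core of the moment-generating-function bound of Lemma B.10.) -/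
theorem mgf_coeff_aux (m : ℕ) (hm : 1 ≤ m) (k : ℕ) :
    2 * (k + 1) * (m + k + 1).factorial ≤
      (m + 1).factorial * (m + 1) ^ k * (k + 2).factorial := by
  induction k with
  | zero => simp [Nat.factorial]; nlinarith
  | succ k ih =>
    have e1 : (m + (k + 1) + 1).factorial = (m + k + 2) * (m + k + 1).factorial := by
      rw [show m + (k + 1) + 1 = (m + k + 1) + 1 by ring, Nat.factorial_succ]
    have e2 : (k + 1 + 2).factorial = (k + 3) * (k + 2).factorial := by
      rw [show k + 1 + 2 = (k + 2) + 1 by ring, Nat.factorial_succ]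
    rw [e1, e2, pow_succ]
    have hk : (k + 2) * (m + k + 2) ≤ (k + 1) * ((m + 1) * (k + 3)) := by
      obtain ⟨j, rfl⟩ := Nat.exists_eq_add_of_le hm
      ring_nf
      nlinarith [Nat.zero_le (j * k), Nat.zero_le (j * k ^ 2), Nat.zero_le (k ^ 2)]
    refine le_of_mul_le_mul_left ?_ (show 0 < k + 1 by omega)
    calc (k + 1) * (2 * (k + 1 + 1) * ((m + k + 2) * (m + k + 1).factorial))
        = ((k + 2) * (m + k + 2)) * (2 * (k + 1) * (m + k + 1).factorial) := by ring
      _ ≤ ((k + 1) * ((m + 1) * (k + 3))) *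
          ((m + 1).factorial * (m + 1) ^ k * (k + 2).factorial) := Nat.mul_le_mul hk ih
      _ = _ := by ring

/-- Shift by two. -/
def mgfShift : ℕ ≃ {r : ℕ // 2 ≤ r} where
  toFun k := ⟨k + 2, by omega⟩
  invFun r := r.1 - 2
  left_inv k := by simp
  right_inv r := by
    apply Subtype.ext
    have := r.2
    simp only
    omega

/-- The series estimate at the core of the moment-generating-function bound of Lemma B.10:
if `3(m+1)λμG² < 1` then the series `Σ_{r≥2} (λ^r/r!) 4(r-1) 3^r μ^r (m+r-1)! G^(2r)`
converges and is at most `2 (m+1)! (3λμG²)² / (1 - 3(m+1)λμG²)`. -/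
theorem mgf_series_bound
    (m : ℕ) (hm : 1 ≤ m) (l μ G : ℝ) (hl : 0 < l) (hμ : 0 < μ) (hG : 0 ≤ G)
    (h : 3 * (m + 1 : ℝ) * l * μ * G ^ 2 < 1) :
    (Summable fun r : {r : ℕ // 2 ≤ r} =>
        l ^ (r : ℕ) / (Nat.factorial (r : ℕ) : ℝ) * (4 * ((r : ℕ) - 1 : ℝ)) *
          3 ^ (r : ℕ) * μ ^ (r : ℕ) * (Nat.factorial (m + (r : ℕ) - 1) : ℝ) *
          G ^ (2 * (r : ℕ))) ∧
      (∑' r : {r : ℕ // 2 ≤ r},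
          l ^ (r : ℕ) / (Nat.factorial (r : ℕ) : ℝ) * (4 * ((r : ℕ) - 1 : ℝ)) *
            3 ^ (r : ℕ) * μ ^ (r : ℕ) * (Nat.factorial (m + (r : ℕ) - 1) : ℝ) *
            G ^ (2 * (r : ℕ))) ≤
        2 * (Nat.factorial (m + 1) : ℝ) * (3 * l * μ * G ^ 2) ^ 2 /
          (1 - 3 * (m + 1 : ℝ) * l * μ * G ^ 2) := by
  set x : ℝ := 3 * l * μ * G ^ 2 with hx
  have hx0 : 0 ≤ x := by positivity
  have hq : 3 * (m + 1 : ℝ) * l * μ * G ^ 2 = (m + 1 : ℝ) * x := by rw [hx]; ring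
  rw [hq] at h ⊢
  have hq0 : 0 ≤ (m + 1 : ℝ) * x := by positivity
  set f : {r : ℕ // 2 ≤ r} → ℝ := fun r =>
    l ^ (r : ℕ) / (Nat.factorial (r : ℕ) : ℝ) * (4 * ((r : ℕ) - 1 : ℝ)) *
          3 ^ (r : ℕ) * μ ^ (r : ℕ) * (Nat.factorial (m + (r : ℕ) - 1) : ℝ) *
          G ^ (2 * (r : ℕ)) with hf
  have hfk : ∀ k : ℕ, f (mgfShift k) =
      2 * x ^ (k + 2) * ((2 * (k + 1) * (m + k + 1).factorial : ℝ) / ((k + 2).factorial : ℝ)) := by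
    intro k
    have e : m + (k + 2) - 1 = m + k + 1 := by omega
    simp only [hf, mgfShift, Equiv.coe_fn_mk, e, hx, mul_pow, pow_mul]
    push_cast
    ring
  have hnn : ∀ k : ℕ, 0 ≤ f (mgfShift k) := by
    intro k
    rw [hfk]
    positivity
  have hle : ∀ k : ℕ, f (mgfShift k) ≤
      2 * ((m + 1).factorial : ℝ) * x ^ 2 * ((m + 1 : ℝ) * x) ^ k := by
    intro k
    rw [hfk]
    have hc : (2 * (k + 1) * (m + k + 1).factorial : ℝ) / ((k + 2).factorial : ℝ) ≤
        ((m + 1).factorial : ℝ) * (m + 1 : ℝ) ^ k := by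
      rw [div_le_iff₀ (by positivity)]
      exact_mod_cast mgf_coeff_aux m hm k
    calc _ ≤ 2 * x ^ (k + 2) * (((m + 1).factorial : ℝ) * (m + 1 : ℝ) ^ k) := by gcongr
      _ = _ := by rw [mul_pow (m + 1 : ℝ) x k]; ring
  have hg := (hasSum_geometric_of_lt_one hq0 h).mul_left (2 * ((m + 1).factorial : ℝ) * x ^ 2)
  have hs : Summable fun k => f (mgfShift k) := Summable.of_nonneg_of_le hnn hle hg.summable
  refine ⟨(mgfShift.summable_iff).1 hs, ?_⟩
  rw [← mgfShift.tsum_eq f, div_eq_mul_inv, ← hg.tsum_eq]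
  exact hs.tsum_le_tsum hle hg.summable
end
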